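/- Let T = 2, d = 1, and define u : Λ̄ → ℝ by u(t,ω) := sup_{0≤s≤t} |ω_s|. Then u is continuous with respect to d_∞, but the map (t,ω) ↦ u(t, ω + 𝟙_{[t,T]}) is NOT continuous with respect to d_∞: for the path ω := −2·𝟙_{[1,2]} one has u(1, ω + 𝟙_{[1,2]}) = 1, while for every n ∈ ℕ one has u(1 + 1/n, ω + 𝟙_{[1+1/n,2]}) = 2 and d_∞((1 + 1/n, ω), (1, ω)) = 1/n. In particular, the set C⁰(Λ̄) of d_∞-continuous functionals u for which (t,ω) ↦ u(t, ω + x·𝟙_{[t,T]}) is d_∞-continuous for every x ∈ ℝ is a strict subset of the set C(Λ̄) of all d_∞-continuous functionals. -/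

import Mathlib

open MeasureTheory Filter Set Topology

noncomputable section

/-- A path `ω : ℝ → E` is càdlàg on `[0,T]`: right-continuous on `[0,T)`
and with left limits on `(0,T]`. -/
def Cadlag {E : Type*} [TopologicalSpace E] (T : ℝ) (ω : ℝ → E) : Prop :=
  (∀ t ∈ Set.Ico (0:ℝ) T, ContinuousWithinAt ω (Set.Ici t) t) ∧
  (∀ t ∈ Set.Ioc (0:ℝ) T, ∃ L, Filter.Tendsto ω (nhdsWithin t (Set.Iio t)) (nhds L))

/-- The pseudometric `d_∞((t,ω),(t',ω')) = |t−t'| + sup_{0≤s≤T} |ω_{s∧t} − ω'_{s∧t'}|`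
on `Λ̄ = [0,T] × D([0,T],ℝ)`. -/
def dInfty (T : ℝ) (p q : ℝ × (ℝ → ℝ)) : ℝ :=
  |p.1 - q.1| + ⨆ s : Set.Icc (0:ℝ) T, |p.2 (min s p.1) - q.2 (min s q.1)|

/-- Continuity of a functional `u : Λ̄ → ℝ` with respect to the pseudometric `d_∞`. -/
def DCont (T : ℝ) (u : ℝ → (ℝ → ℝ) → ℝ) : Prop :=
  ∀ t ∈ Set.Icc (0:ℝ) T, ∀ ω : ℝ → ℝ, Cadlag T ω → ∀ ε > (0:ℝ), ∃ δ > (0:ℝ),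
    ∀ t' ∈ Set.Icc (0:ℝ) T, ∀ ω' : ℝ → ℝ, Cadlag T ω' →
      dInfty T (t, ω) (t', ω') < δ → |u t ω - u t' ω'| < ε

/-- The running maximum functional `u(t,ω) = sup_{0≤s≤t} |ω_s|`. -/
def runMax (t : ℝ) (ω : ℝ → ℝ) : ℝ := ⨆ s : Set.Icc (0:ℝ) t, |ω s|

/-- The path `ω + x·𝟙_{[t,T]}`. -/
def bump (x t : ℝ) (ω : ℝ → ℝ) : ℝ → ℝ := fun s => ω s + if t ≤ s then x else 0

/-- The path `−2·𝟙_{[1,2]}` (as a path on `[0,2]`). -/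
def omega0 : ℝ → ℝ := fun s => if 1 ≤ s then -2 else 0

/-- A real-valued càdlàg path is bounded on `[0,T]`. -/
theorem Cadlag.exists_abs_le {T : ℝ} {ω : ℝ → ℝ} (h : Cadlag T ω) :
    ∃ C, ∀ s ∈ Set.Icc (0:ℝ) T, |ω s| ≤ C := by
  refine isCompact_Icc.induction_on (p := fun S : Set ℝ => ∃ C, ∀ s ∈ S, |ω s| ≤ C)
    ⟨0, by simp⟩ ?_ ?_ ?_
  · rintro S S' hS ⟨C, hC⟩
    exact ⟨C, fun s hs => hC s (hS hs)⟩
  · rintro S S' ⟨C, hC⟩ ⟨C', hC'⟩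
    refine ⟨max C C', ?_⟩
    rintro s (hs | hs)
    · exact (hC s hs).trans (le_max_left _ _)
    · exact (hC' s hs).trans (le_max_right _ _)
  · intro x hx
    have left_bound : ∃ C, ∀ᶠ y in 𝓝[Set.Icc 0 T ∩ Set.Iio x] x, |ω y| ≤ C := by
      rcases hx.1.eq_or_lt with rfl | h0
      · refine ⟨0, eventually_mem_nhdsWithin.mono ?_⟩
        rintro y ⟨hy, hy'⟩
        exact absurd hy.1 (not_le.2 hy')
      · obtain ⟨L, hL⟩ := h.2 x ⟨h0, hx.2⟩
        exact ⟨|L| + 1, (nhdsWithin_mono x Set.inter_subset_right)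
          (hL.abs.eventually_le_const (lt_add_one _))⟩
    have right_bound : ∃ C, ∀ᶠ y in 𝓝[Set.Icc 0 T ∩ Set.Ici x] x, |ω y| ≤ C := by
      rcases hx.2.eq_or_lt with rfl | hT
      · refine ⟨|ω x|, eventually_mem_nhdsWithin.mono ?_⟩
        rintro y ⟨hy, hy'⟩
        rw [le_antisymm hy.2 hy']
      · have hL : Tendsto ω (𝓝[≥] x) (𝓝 (ω x)) := h.1 x ⟨hx.1, hT⟩
        exact ⟨|ω x| + 1, (nhdsWithin_mono x Set.inter_subset_right)
          (hL.abs.eventually_le_const (lt_add_one _))⟩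
    obtain ⟨C, hC⟩ := left_bound
    obtain ⟨C', hC'⟩ := right_bound
    refine ⟨{y | |ω y| ≤ max C C'}, ?_, max C C', fun s hs => hs⟩
    have hsplit : Set.Icc 0 T = Set.Icc 0 T ∩ Set.Iio x ∪ Set.Icc 0 T ∩ Set.Ici x := by
      rw [← Set.inter_union_distrib_left, Set.Iio_union_Ici, Set.inter_univ]
    rw [hsplit, nhdsWithin_union]
    exact ⟨hC.mono fun y hy => hy.trans (le_max_left _ _),
      hC'.mono fun y hy => hy.trans (le_max_right _ _)⟩

theorem dInfty_comm (T : ℝ) (p q : ℝ × (ℝ → ℝ)) : dInfty T p q = dInfty T q p := by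
  simp only [dInfty, abs_sub_comm]

/-- The supremum in `dInfty` bounds each of its terms, for càdlàg paths. -/
theorem abs_sub_le_dInfty {T t t' : ℝ} {ω ω' : ℝ → ℝ} (ht : t ∈ Set.Icc 0 T)
    (ht' : t' ∈ Set.Icc 0 T) (h : Cadlag T ω) (h' : Cadlag T ω') {s : ℝ}
    (hs : s ∈ Set.Icc 0 T) :
    |ω (min s t) - ω' (min s t')| ≤ dInfty T (t, ω) (t', ω') := by
  obtain ⟨C, hC⟩ := h.exists_abs_le
  obtain ⟨C', hC'⟩ := h'.exists_abs_le
  have hbdd : BddAbove (Set.range fun s : Set.Icc (0:ℝ) T =>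
      |ω (min s t) - ω' (min s t')|) := by
    refine ⟨C + C', ?_⟩
    rintro _ ⟨r, rfl⟩
    exact (abs_sub _ _).trans (add_le_add
      (hC _ ⟨le_min r.2.1 ht.1, (min_le_left _ _).trans r.2.2⟩)
      (hC' _ ⟨le_min r.2.1 ht'.1, (min_le_left _ _).trans r.2.2⟩))
  have hle := le_ciSup hbdd ⟨s, hs⟩
  have h0 := abs_nonneg (t - t')
  simp only [dInfty] at hle ⊢
  linarith

theorem abs_le_runMax {T t : ℝ} {ω : ℝ → ℝ} (h : Cadlag T ω) (ht : t ≤ T) {s : ℝ}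
    (hs : s ∈ Set.Icc 0 t) : |ω s| ≤ runMax t ω := by
  obtain ⟨C, hC⟩ := h.exists_abs_le
  refine le_ciSup (f := fun s : Set.Icc (0:ℝ) t => |ω s|) ⟨C, ?_⟩ ⟨s, hs⟩
  rintro _ ⟨r, rfl⟩
  exact hC r ⟨r.2.1, r.2.2.trans ht⟩

theorem runMax_le_add_dInfty {T t t' : ℝ} {ω ω' : ℝ → ℝ} (ht : t ∈ Set.Icc 0 T)
    (ht' : t' ∈ Set.Icc 0 T) (h : Cadlag T ω) (h' : Cadlag T ω') :
    runMax t ω ≤ runMax t' ω' + dInfty T (t, ω) (t', ω') := by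
  have : Nonempty (Set.Icc (0:ℝ) t) := ⟨⟨0, le_rfl, ht.1⟩⟩
  refine ciSup_le fun s => ?_
  have h1 := abs_sub_le_dInfty ht ht' h h' (s := s) ⟨s.2.1, s.2.2.trans ht.2⟩
  rw [min_eq_left s.2.2] at h1
  have h2 := abs_le_runMax h' ht'.2 (s := min s t') ⟨le_min s.2.1 ht'.1, min_le_right _ _⟩
  have h3 := abs_sub_abs_le_abs_sub (ω s) (ω' (min s t'))
  linarith

/-- The running maximum is `1`-Lipschitz for `d_∞`, hence continuous. -/
theorem dCont_runMax (T : ℝ) : DCont T runMax := by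
  intro t ht ω h ε hε
  refine ⟨ε, hε, fun t' ht' ω' h' hd => ?_⟩
  have h1 := runMax_le_add_dInfty ht ht' h h'
  have h2 := runMax_le_add_dInfty ht' ht h' h
  rw [dInfty_comm] at h2
  rw [abs_lt]
  constructor <;> linarith

theorem cadlag_omega0 (T : ℝ) : Cadlag T omega0 := by
  have const_below : ∀ s < 1, omega0 s = 0 := fun s hs => if_neg (not_le.2 hs)
  have const_above : ∀ s, 1 ≤ s → omega0 s = -2 := fun s hs => if_pos hs
  constructor
  · intro t _
    rcases lt_or_ge t 1 with h | h
    · refine (continuousAt_const.congr (f := fun _ => (0:ℝ)) ?_).continuousWithinAt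
      filter_upwards [Iio_mem_nhds h] with s hs using (const_below s hs).symm
    · exact continuousWithinAt_const.congr (f := fun _ => (-2:ℝ))
        (fun s hs => const_above s (h.trans hs)) (const_above t h)
  · intro t _
    rcases le_or_gt t 1 with h | h
    · refine ⟨0, tendsto_const_nhds.congr' ?_⟩
      filter_upwards [self_mem_nhdsWithin] with s hs
      exact (const_below s (lt_of_lt_of_le hs h)).symm
    · refine ⟨-2, tendsto_const_nhds.congr' ?_⟩
      filter_upwards [mem_nhdsWithin_of_mem_nhds (Ioi_mem_nhds h)] with s hs
      exact (const_above s (le_of_lt hs)).symm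

theorem runMax_eq_of_isGreatest {t M : ℝ} {ω : ℝ → ℝ}
    (hle : ∀ s ∈ Set.Icc 0 t, |ω s| ≤ M) {r : ℝ} (hr : r ∈ Set.Icc 0 t) (hM : |ω r| = M) :
    runMax t ω = M := by
  refine IsGreatest.csSup_eq ⟨⟨⟨r, hr⟩, hM⟩, ?_⟩
  rintro _ ⟨s, rfl⟩
  exact hle s s.2

theorem runMax_bump_one : runMax 1 (bump 1 1 omega0) = 1 := by
  refine runMax_eq_of_isGreatest (r := 1) ?_ (by simp) (by norm_num [bump, omega0])
  intro s _
  simp only [bump, omega0]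
  split_ifs <;> norm_num

theorem runMax_bump_of_one_lt {t : ℝ} (ht : 1 < t) : runMax t (bump 1 t omega0) = 2 := by
  refine runMax_eq_of_isGreatest (r := 1) ?_ ⟨zero_le_one, ht.le⟩
    (by norm_num [bump, omega0, ht.not_ge])
  intro s _
  simp only [bump, omega0]
  split_ifs <;> norm_num

theorem dInfty_omega0_of_one_le (T : ℝ) {t : ℝ} (ht : 1 ≤ t) :
    dInfty T (t, omega0) (1, omega0) = t - 1 := by
  have h : ∀ s : ℝ, omega0 (min s t) = omega0 (min s 1) := by
    intro s
    simp [omega0, ht]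
  simp only [dInfty, h, sub_self, abs_zero, Real.iSup_const_zero, add_zero]
  exact abs_of_nonneg (sub_nonneg.2 ht)

theorem not_dCont_runMax_bump : ¬ DCont 2 (fun t ω => runMax t (bump 1 t ω)) := by
  intro h
  obtain ⟨δ, hδ, hcont⟩ := h 1 (by norm_num) omega0 (cadlag_omega0 2) 1 one_pos
  have hpos : 0 < min (δ / 2) 1 := lt_min (half_pos hδ) one_pos
  have ht : 1 < 1 + min (δ / 2) 1 := lt_add_of_pos_right 1 hpos
  have hmem : 1 + min (δ / 2) 1 ∈ Set.Icc (0:ℝ) 2 :=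
    ⟨by linarith, by linarith [min_le_right (δ / 2) 1]⟩
  have hlt := hcont _ hmem omega0 (cadlag_omega0 2) (by
    rw [dInfty_comm, dInfty_omega0_of_one_le 2 ht.le]
    linarith [min_le_left (δ / 2) 1])
  simp only [runMax_bump_one, runMax_bump_of_one_lt ht] at hlt
  norm_num at hlt

/-- With `T = 2`, the functional `u(t,ω) = sup_{0≤s≤t}|ω_s|` is
`d_∞`-continuous, but `(t,ω) ↦ u(t, ω + 𝟙_{[t,T]})` is not: for `ω = −2·𝟙_{[1,2]}` one has
`u(1, ω + 𝟙_{[1,2]}) = 1` while `u(1+1/n, ω + 𝟙_{[1+1/n,2]}) = 2` and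
`d_∞((1+1/n,ω),(1,ω)) = 1/n`.  In particular `C⁰(Λ̄) ⊊ C(Λ̄)`. -/
theorem stmt10 :
    DCont 2 runMax ∧
    runMax 1 (bump 1 1 omega0) = 1 ∧
    (∀ n : ℕ, 0 < n →
      runMax (1 + 1 / (n : ℝ)) (bump 1 (1 + 1 / (n : ℝ)) omega0) = 2 ∧
      dInfty 2 (1 + 1 / (n : ℝ), omega0) (1, omega0) = 1 / (n : ℝ)) ∧
    ¬ DCont 2 (fun t ω => runMax t (bump 1 t ω)) := by
  refine ⟨dCont_runMax 2, runMax_bump_one, fun n hn => ?_, not_dCont_runMax_bump⟩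
  have ht : 1 < 1 + 1 / (n : ℝ) := lt_add_of_pos_right 1 (by positivity)
  exact ⟨runMax_bump_of_one_lt ht,
    (dInfty_omega0_of_one_le 2 ht.le).trans (add_sub_cancel_left _ _)⟩
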